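/- Let κ be an algebraically closed field and let A be a reduced finitely generated κ-algebra which is equidimensional of Krull dimension d, i.e. A/q has Krull dimension d for every minimal prime q of A. Then for a prime ideal p of A, the classical Fitting ideal satisfies Fitt_d(Ω_{A/κ}) ⊆ p if and only if the localization A_p is not a formally smooth κ-algebra. In other words, the closed subscheme of Spec A defined by Fitt_d(Ω_{A/κ}) is supported exactly on the non-smooth locus of A over κ. -/

import Mathlib

/-- The ideal of `t × t` minors of a matrix, with the conventions that it is the
unit ideal for `t ≤ 0` and the zero ideal when `t` exceeds the size of the matrix. -/
noncomputable def minorsIdeal {R : Type} [CommRing R] {n m : ℕ}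
    (M : Matrix (Fin n) (Fin m) R) (t : ℤ) : Ideal R :=
  if t ≤ 0 then ⊤
  else Ideal.span {x | ∃ (f : Fin t.toNat → Fin n) (g : Fin t.toNat → Fin m),
    Function.Injective f ∧ Function.Injective g ∧ x = (M.submatrix f g).det}

open TensorProduct
open scoped Matrix

lemma aux_dim {R S : Type*} [CommRing R] [CommRing S] [IsDomain S] [Algebra R S] [Algebra.IsIntegral R S]
    (hinj : Function.Injective (algebraMap R S)) : ringKrullDim S = ringKrullDim R := by
  apply le_antisymm
  · refine Order.krullDim_le_of_strictMono (PrimeSpectrum.comap (algebraMap R S)) ?_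
    intro I J h
    exact Ideal.IsIntegral.comap_lt_comap h
  · refine iSup_le fun l ↦ ?_
    obtain ⟨P, hP, h⟩ := Ideal.exists_ideal_over_prime_of_isIntegral_of_isDomain (S := S) l.head.asIdeal
      (by rw [(RingHom.injective_iff_ker_eq_bot _).1 hinj]; exact bot_le)
    have : P.LiesOver (RelSeries.head l).asIdeal := ⟨h.symm⟩
    obtain ⟨L, hL, -⟩ := Ideal.exists_ltSeries_of_hasGoingUp l P
    rw [← hL]
    exact Order.LTSeries.length_le_krullDim L

lemma aux_trdeg {κ B L : Type} [Field κ] [CommRing B] [IsDomain B] [Algebra κ B]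
    [Algebra.FiniteType κ B] [Field L] [Algebra κ L] [Algebra B L] [IsScalarTower κ B L]
    [IsFractionRing B L] (d : ℕ) (h : ringKrullDim B = d) : Algebra.trdeg κ L = d := by
  obtain ⟨s, g, hg, hi⟩ := exists_integral_inj_algHom_of_fg κ B
  let := g.toRingHom.toAlgebra
  have hi : Algebra.IsIntegral (MvPolynomial (Fin s) κ) B := ⟨hi⟩
  have hd := aux_dim (R := MvPolynomial (Fin s) κ) (S := B) hg
  rw [MvPolynomial.ringKrullDim_of_isNoetherianRing, h] at hd
  have hs : d = s := by
    simp at hd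
    exact_mod_cast hd
  subst hs
  have : IsScalarTower κ (MvPolynomial (Fin d) κ) B := .of_algebraMap_eq fun x ↦ (g.commutes x).symm
  have : FaithfulSMul (MvPolynomial (Fin d) κ) B := (faithfulSMul_iff_algebraMap_injective _ _).2 hg
  have h1 := trdeg_add_eq κ (MvPolynomial (Fin d) κ) (A := B)
  have h2 := trdeg_add_eq κ B (A := L)
  have : Algebra.IsAlgebraic B L := IsLocalization.isAlgebraic _ (nonZeroDivisors B)
  rw [trdeg_eq_zero (R := MvPolynomial (Fin d) κ)] at h1
  rw [trdeg_eq_zero (R := B)] at h2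
  simp at h1 h2
  rw [← h2, ← h1]

lemma aux_cols {K : Type*} [Field K] {n m : Type*} [Fintype n] [Fintype m] (M : Matrix n m K) (t : ℕ)
    (h : t ≤ M.rank) : ∃ g : Fin t → m, Function.Injective g ∧ LinearIndependent K (M.col ∘ g) := by
  obtain ⟨ι, a, ha, hsp, hli⟩ := exists_linearIndependent' K M.col
  have : Finite ι := Finite.of_injective a ha
  have := Fintype.ofFinite ι
  have hc : M.rank = Fintype.card ι := by
    rw [Matrix.rank_eq_finrank_span_cols, ← hsp, finrank_span_eq_card hli]
  rw [hc] at h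
  let e : Fin t → ι := fun i ↦ (Fintype.equivFin ι).symm (Fin.castLE h i)
  have he : Function.Injective e := (Fintype.equivFin ι).symm.injective.comp (Fin.castLE_injective h)
  exact ⟨a ∘ e, ha.comp he, hli.comp e he⟩

lemma aux_minors {K : Type*} [Field K] {n m : Type*} [Fintype n] [Fintype m] (M : Matrix n m K) (t : ℕ) :
    (∃ (f : Fin t → n) (g : Fin t → m), Function.Injective f ∧ Function.Injective g ∧
      (M.submatrix f g).det ≠ 0) ↔ t ≤ M.rank := by
  constructor
  · rintro ⟨f, g, -, -, h⟩
    simpa [Matrix.rank_of_det_ne_zero h] using Matrix.rank_submatrix_le M f g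
  · intro h
    obtain ⟨g, hg, hli⟩ := aux_cols M t h
    have h2 : t ≤ (M.submatrix id g)ᵀ.rank := by
      have : LinearIndependent K ((M.submatrix id g)ᵀ).row := hli
      simpa using this.rank_matrix.ge
    obtain ⟨f, hf, hli'⟩ := aux_cols _ t h2
    refine ⟨f, g, hf, hg, ?_⟩
    have : LinearIndependent K (M.submatrix f g).row := hli'
    rw [Matrix.linearIndependent_rows_iff_isUnit, Matrix.isUnit_iff_isUnit_det] at this
    exact this.ne_zero

lemma aux_fitt {A k N : Type} [CommRing A] [Field k] [Algebra A k] [AddCommGroup N] [Module A N]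
    (d m r : ℕ) (φ : (Fin m → A) →ₗ[A] (Fin r → A))
    (π : (Fin r → A) →ₗ[A] N)
    (hπ : Function.Surjective π)
    (hexact : LinearMap.range φ = LinearMap.ker π)
    (p : Ideal A) (hp : RingHom.ker (algebraMap A k) = p) :
    minorsIdeal (LinearMap.toMatrix (Pi.basisFun A (Fin m)) (Pi.basisFun A (Fin r)) φ)
        ((r : ℤ) - (d : ℤ)) ≤ p ↔ d < Module.finrank k (k ⊗[A] N) := by
  set M := LinearMap.toMatrix (Pi.basisFun A (Fin m)) (Pi.basisFun A (Fin r)) φ with hM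
  have hrank : Module.finrank k (k ⊗[A] N) + (M.map (algebraMap A k)).rank = r := by
    have e1 : M.map (algebraMap A k) = LinearMap.toMatrix (Algebra.TensorProduct.basis k (Pi.basisFun A (Fin m)))
        (Algebra.TensorProduct.basis k (Pi.basisFun A (Fin r))) (φ.baseChange k) := by
      rw [LinearMap.toMatrix_baseChange]
    rw [e1, Matrix.rank_eq_finrank_range_toLin _ (Algebra.TensorProduct.basis k (Pi.basisFun A (Fin r)))
      (Algebra.TensorProduct.basis k (Pi.basisFun A (Fin m))), Matrix.toLin_toMatrix]
    have hex : Function.Exact (φ.baseChange k) (π.baseChange k) := 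
      lTensor_exact k (LinearMap.exact_iff.2 hexact.symm) hπ
    have hs : Function.Surjective (π.baseChange k) := LinearMap.lTensor_surjective k hπ
    have := LinearMap.finrank_range_add_finrank_ker (π.baseChange k)
    rw [LinearMap.range_eq_top.2 hs, finrank_top, LinearMap.exact_iff.1 hex] at this
    rw [this, Module.finrank_eq_card_basis (Algebra.TensorProduct.basis k (Pi.basisFun A (Fin r))),
      Fintype.card_fin]
  have hmap : ∀ x, x ∈ p ↔ algebraMap A k x = 0 := fun x ↦ by rw [← hp, RingHom.mem_ker]
  unfold minorsIdeal
  split_ifs with h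
  · refine iff_of_false ?_ (by omega)
    intro h
    have : (1 : A) ∈ p := h trivial
    rw [hmap, map_one] at this
    exact one_ne_zero this
  · obtain ⟨t, ht⟩ : ∃ t : ℕ, (r : ℤ) - d = t := ⟨((r : ℤ) - d).toNat, by omega⟩
    rw [ht, Int.toNat_natCast, Ideal.span_le]
    have := aux_minors (M.map (algebraMap A k)) t
    rw [← not_iff_not] at this
    have e : d < Module.finrank k (k ⊗[A] N) ↔ ¬ t ≤ (M.map (algebraMap A k)).rank := by omega
    rw [e, ← this]
    constructor
    · rintro h ⟨f, g, hf, hg, h0⟩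
      apply h0
      have := (hmap _).1 (h ⟨f, g, hf, hg, rfl⟩)
      rwa [RingHom.map_det] at this
    · rintro h _ ⟨f, g, hf, hg, rfl⟩
      by_contra h0
      apply h
      refine ⟨f, g, hf, hg, fun h1 ↦ h0 ?_⟩
      rw [SetLike.mem_coe, hmap, RingHom.map_det]
      exact h1

lemma aux_vnr {F : Type*} [CommRing F] [IsArtinianRing F] [IsReduced F] (x : F) :
    ∃ y, x * x * y = x := by
  obtain ⟨n, y, h⟩ := IsArtinian.exists_pow_succ_smul_dvd x (1 : F)
  simp only [smul_eq_mul, mul_one, Nat.succ_eq_add_one] at h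
  refine ⟨y, ?_⟩
  have h1 : (x - x * x * y) ^ (n + 1) = 0 := by
    have : x - x * x * y = x * (1 - x * y) := by ring
    rw [this, mul_pow]
    have h2 : x ^ (n+1) * (1 - x * y) = 0 := by
      linear_combination -x * h
    rw [pow_succ (1 - x * y)]
    linear_combination (1 - x * y) ^ n * h2
  have := pow_eq_zero_iff (n := n+1) (by omega) |>.1 h1
  exact (sub_eq_zero.1 this).symm

lemma aux_idem {R E : Type} [CommRing R] [IsDomain R] [IsIntegrallyClosed R] [CommRing E]
    [Algebra R E] [Algebra.Etale R E] (x : E) :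
    ∃ e y : E, ∃ c : R, c ≠ 0 ∧ e * e = e ∧ e * x = x ∧ c • e = x * y := by
  let K := FractionRing R
  have hfl : Module.Flat R E := inferInstance
  have hinj : Function.Injective (algebraMap E (E ⊗[R] K)) := 
    Algebra.TensorProduct.includeLeft_injective (S := R) (FaithfulSMul.algebraMap_injective R K)
  let eqv := (Algebra.TensorProduct.comm R K E).toRingEquiv
  have := Algebra.FormallyUnramified.finite_of_free (R := K) (S := K ⊗[R] E)
  have : IsArtinianRing (K ⊗[R] E) := isArtinian_of_tower K inferInstance
  have : IsReduced (K ⊗[R] E) := Algebra.FormallyUnramified.isReduced_of_field K _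
  have : IsArtinianRing (E ⊗[R] K) := eqv.surjective.isArtinianRing
  have : IsReduced (E ⊗[R] K) := isReduced_of_injective eqv.symm eqv.symm.injective
  obtain ⟨y, hy⟩ := aux_vnr (algebraMap E (E ⊗[R] K) x)
  set x' := algebraMap E (E ⊗[R] K) x
  have hid : (x' * y) * (x' * y) = x' * y := by linear_combination y * hy
  have hint : IsIntegral E (x' * y) := by
    refine ⟨Polynomial.X ^ 2 - Polynomial.X, Polynomial.monic_X_pow_sub (Polynomial.degree_X_le.trans_lt (by norm_num)), ?_⟩
    simp [pow_two, hid]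
  obtain ⟨z, hz⟩ := (TensorProduct.toIntegralClosure_bijective_of_smooth (R := R) (S := E) (B := K)).2
    ⟨_, hint⟩
  have hz' : ∀ z : E ⊗[R] integralClosure R K, ∃ e : E, (TensorProduct.toIntegralClosure R E K z).1 =
      algebraMap E (E ⊗[R] K) e := by
    intro z
    induction z with
    | zero => exact ⟨0, by simp⟩
    | add a b ha hb =>
      obtain ⟨a', ha⟩ := ha
      obtain ⟨b', hb⟩ := hb
      exact ⟨a' + b', by simp [ha, hb]⟩
    | tmul a b =>
      obtain ⟨b', hb⟩ := IsIntegrallyClosed.isIntegral_iff.1 b.2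
      refine ⟨b' • a, ?_⟩
      have : (TensorProduct.toIntegralClosure R E K (a ⊗ₜ[R] b)).1 = a ⊗ₜ[R] b.1 := by
        simp [TensorProduct.toIntegralClosure]
      rw [this, ← hb, Algebra.TensorProduct.algebraMap_apply, Algebra.algebraMap_self_apply,
        TensorProduct.smul_tmul, Algebra.smul_def, mul_one]
  obtain ⟨e, he⟩ := hz' z
  rw [hz] at he
  simp only at he
  have hy' : ∀ y : E ⊗[R] K, ∃ (c : R) (y' : E), c ≠ 0 ∧ c • y = algebraMap E _ y' := by
    intro y
    induction y with
    | zero => exact ⟨1, 0, one_ne_zero, by simp⟩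
    | add a b ha hb =>
      obtain ⟨c, a', hc, ha⟩ := ha
      obtain ⟨c', b', hc', hb⟩ := hb
      refine ⟨c * c', c' • a' + c • b', mul_ne_zero hc hc', ?_⟩
      rw [map_add, Algebra.algebraMap_eq_smul_one, Algebra.algebraMap_eq_smul_one, smul_assoc, smul_assoc,
        ← Algebra.algebraMap_eq_smul_one, ← Algebra.algebraMap_eq_smul_one, ← ha, ← hb, smul_add,
        mul_smul, mul_smul, smul_comm c]
    | tmul a b =>
      obtain ⟨⟨u, c⟩, h⟩ := IsLocalization.surj (nonZeroDivisors R) b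
      refine ⟨c, u • a, nonZeroDivisors.ne_zero c.2, ?_⟩
      simp only at h
      rw [Algebra.TensorProduct.algebraMap_apply, Algebra.algebraMap_self_apply,
        TensorProduct.smul_tmul, ← TensorProduct.tmul_smul,
        Algebra.smul_def, mul_comm, h, Algebra.smul_def, mul_one]
  obtain ⟨c, y', hc, hcy⟩ := hy' y
  refine ⟨e, y', c, hc, hinj ?_, hinj ?_, hinj ?_⟩
  · rw [map_mul, ← he, hid]
  · rw [map_mul, ← he]; change _ * x' = x'; linear_combination hy
  · rw [map_mul, ← hcy, Algebra.algebraMap_eq_smul_one, smul_assoc, ← Algebra.algebraMap_eq_smul_one, ← he]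
    exact (mul_smul_comm c _ _).symm

lemma aux_loc {R E T : Type} [CommRing R] [IsDomain R] [IsIntegrallyClosed R] [CommRing E]
    [Algebra R E] [Algebra.Etale R E] [CommRing T] [IsLocalRing T] [Algebra E T] [Algebra R T]
    [IsScalarTower R E T] (hinj : Function.Injective (algebraMap R T))
    (hs : ∀ z : T, ∃ x s : E, IsUnit (algebraMap E T s) ∧ z * algebraMap E T s = algebraMap E T x) :
    Algebra.FormallyEtale R T := by
  let n : Ideal E := (IsLocalRing.maximalIdeal T).comap (algebraMap E T)
  have hn : ∀ x, x ∈ n.primeCompl ↔ IsUnit (algebraMap E T x) := by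
    intro x
    simp [n, Ideal.primeCompl]
  have : IsLocalization n.primeCompl T := by
    constructor
    constructor
    · intro y; exact (hn _).1 y.2
    · intro z
      obtain ⟨x, s, h, h'⟩ := hs z
      exact ⟨⟨x, ⟨s, (hn _).2 h⟩⟩, h'⟩
    · intro x y hxy
      obtain ⟨e, z, c, hc, h1, h2, h3⟩ := aux_idem (R := R) (x - y)
      have h0 : algebraMap E T (x - y) = 0 := by rw [map_sub, hxy, sub_self]
      refine ⟨⟨1 - e, (hn _).2 ?_⟩, ?_⟩
      · rw [map_sub, map_one]
        have : IsUnit (algebraMap E T e) ∨ IsUnit (1 - algebraMap E T e) :=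
          IsLocalRing.isUnit_or_isUnit_one_sub_self _
        refine this.resolve_left fun hu ↦ ?_
        have h4 := congr(algebraMap E T $h3)
        rw [map_mul, h0, zero_mul, Algebra.smul_def, map_mul, ← IsScalarTower.algebraMap_apply] at h4
        rw [hu.mul_left_eq_zero] at h4
        exact hc (hinj (by rw [h4, map_zero]))
      · simp only
        linear_combination -h2
  have : Algebra.FormallyEtale E T := .of_isLocalization n.primeCompl
  exact .comp R E T

lemma aux_indep {κ L ι : Type} [Field κ] [Field L] [Algebra κ L] [Algebra.EssFiniteType κ L]
    [Finite ι] [Algebra (MvPolynomial ι κ) L] [IsScalarTower κ (MvPolynomial ι κ) L]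
    [Algebra.FormallyUnramified (MvPolynomial ι κ) L]
    (hle : Cardinal.mk ι ≤ Algebra.trdeg κ L) :
    Function.Injective (algebraMap (MvPolynomial ι κ) L) := by
  let x : ι → L := fun i => algebraMap (MvPolynomial ι κ) L (MvPolynomial.X i)
  have hx : MvPolynomial.aeval x = IsScalarTower.toAlgHom κ (MvPolynomial ι κ) L := by
    ext i; simp [x]
  let F := IntermediateField.adjoin κ (Set.range x)
  let y : ι → F := fun i => ⟨x i, IntermediateField.subset_adjoin _ _ ⟨i, rfl⟩⟩
  let : Algebra (MvPolynomial ι κ) F := (MvPolynomial.aeval y).toRingHom.toAlgebra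
  have : IsScalarTower (MvPolynomial ι κ) F L := by
    refine IsScalarTower.of_algebraMap_eq' ?_
    have : (IsScalarTower.toAlgHom κ (MvPolynomial ι κ) L) =
      (IsScalarTower.toAlgHom κ F L).comp (MvPolynomial.aeval y) := by
      ext i; simp [x, y]
    exact congrArg AlgHom.toRingHom this
  have : Algebra.FormallyUnramified F L := .of_restrictScalars (MvPolynomial ι κ) F L
  have : Algebra.EssFiniteType F L := .of_comp κ F L
  have : Algebra.IsSeparable F L := Algebra.FormallyUnramified.isSeparable F L
  have h1 : Algebra.IsAlgebraic F L := inferInstance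
  have : Algebra.IsAlgebraic (Algebra.adjoin κ (Set.range x)) L :=
    IntermediateField.isAlgebraic_adjoin_iff_top.mp h1
  have := (Algebra.IsAlgebraic.isTranscendenceBasis_of_le_trdeg_of_finite κ x hle).1
  rw [AlgebraicIndependent, hx] at this
  exact this

open scoped IntermediateField.algebraAdjoinAdjoin in
lemma aux_diff {κ L : Type} [Field κ] [PerfectField κ] [Field L] [Algebra κ L]
    [Algebra.EssFiniteType κ L] (d : ℕ) (hd : Algebra.trdeg κ L = d) :
    Module.finrank L (KaehlerDifferential κ L) = d := by
  obtain ⟨s, hs, H⟩ := exists_isTranscendenceBasis_and_isSeparable_of_perfectField κ L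
  have : Algebra.IsSeparable (↥(IntermediateField.adjoin κ (Set.range ((↑) : s → L)))) L := by
    convert! H <;> simp
  let v : s → L := (↑)
  let B := Algebra.adjoin κ (Set.range v)
  let F := IntermediateField.adjoin κ (Set.range v)
  let P := MvPolynomial s κ
  let : Algebra P B := (hs.1.aevalEquiv).toRingEquiv.toRingHom.toAlgebra
  have : IsScalarTower κ P B := .of_algebraMap_eq fun x => (hs.1.aevalEquiv.commutes x).symm
  let : Algebra P F := ((algebraMap B F).comp (algebraMap P B)).toAlgebra
  let : Algebra P L := ((algebraMap B L).comp (algebraMap P B)).toAlgebra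
  have : IsScalarTower P B F := .of_algebraMap_eq' rfl
  have : IsScalarTower P B L := .of_algebraMap_eq' rfl
  have : IsScalarTower P F L := .of_algebraMap_eq fun x => by
    change _ = algebraMap F L (algebraMap B F _)
    rw [← IsScalarTower.algebraMap_apply B F L]; rfl
  have : IsScalarTower κ P L := .of_algebraMap_eq fun x => by
    rw [IsScalarTower.algebraMap_apply P B L, ← IsScalarTower.algebraMap_apply κ P B,
      ← IsScalarTower.algebraMap_apply κ B L]
  have : Algebra.FormallyEtale P B :=
    .of_equiv (AlgEquiv.ofBijective (Algebra.ofId P B) hs.1.aevalEquiv.bijective)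
  have : Algebra.FormallyEtale B F := .of_isLocalization (nonZeroDivisors _)
  have : Algebra.FormallyEtale F L := Algebra.FormallyEtale.of_isSeparable _ L
  have : Algebra.FormallyEtale P F := .comp P B F
  have : Algebra.FormallyEtale P L := .comp P F L
  rw [← (KaehlerDifferential.tensorKaehlerEquivOfFormallyEtale κ P L).finrank_eq]
  rw [Module.finrank_eq_card_basis ((KaehlerDifferential.mvPolynomialBasis κ s).baseChange L)]
  have := hs.cardinalMk_eq_trdeg
  rw [hd] at this
  simpa using this
open KaehlerDifferential in
lemma aux_unram {κ P A : Type} [Field κ] [CommRing A] [Algebra κ A] [CommRing P] [Algebra κ P]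
    [Algebra P A] [IsScalarTower κ P A] [Algebra.FiniteType P A] (p : Ideal A) [p.IsPrime]
    {ι : Type} (a : ι → P)
    (h : Submodule.span p.ResidueField (Set.range fun i : ι =>
      ((1 : p.ResidueField) ⊗ₜ[A] D κ A (algebraMap P A (a i)) : p.ResidueField ⊗[A] Ω[A⁄κ])) = ⊤) :
    Algebra.FormallyUnramified P (Localization.AtPrime p) := by
  let T := Localization.AtPrime p
  let k := p.ResidueField
  have : Algebra.EssFiniteType P T := .comp P A T
  refine ⟨?_⟩
  rw [← IsLocalRing.subsingleton_tensorProduct (R := T)]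
  let g : Ω[T⁄P] →ₗ[T] k ⊗[T] Ω[T⁄P] := TensorProduct.mk T k _ 1
  let f : Ω[A⁄κ] →ₗ[A] k ⊗[T] Ω[T⁄P] := (g.restrictScalars A).comp (map κ P A T)
  have hz : LinearMap.liftBaseChange k f = 0 := by
    refine LinearMap.ext_on_range h fun i => ?_
    simp [f, ← IsScalarTower.algebraMap_apply P A T]
  have hf : f = 0 := by
    refine LinearMap.ext fun x => ?_
    have := congrArg (fun l => l (1 ⊗ₜ x)) hz
    simpa using this
  have hg : g = 0 := by
    refine LinearMap.ext_on_range
      (span_range_map_derivation_of_isLocalization P A T p.primeCompl) fun x => ?_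
    have := congrArg (fun l => l (D κ A x)) hf
    simpa [f] using this
  refine subsingleton_of_forall_eq 0 fun z => ?_
  induction z with
  | zero => rfl
  | add x y hx hy => rw [hx, hy, add_zero]
  | tmul c w =>
    have : (1 : k) ⊗ₜ[T] w = 0 := congrArg (fun l => l w) hg
    rw [← mul_one c, ← smul_eq_mul, ← TensorProduct.smul_tmul', this, smul_zero]

open KaehlerDifferential in
lemma aux_smooth {κ A L : Type} [Field κ] [CommRing A] [Algebra κ A] [Algebra.FiniteType κ A]
    (p : Ideal A) [p.IsPrime] [Field L] [Algebra κ L] [Algebra.EssFiniteType κ L] [Algebra A L]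
    [IsScalarTower κ A L] [Algebra.FormallyUnramified A L]
    [Algebra (Localization.AtPrime p) L] [IsScalarTower A (Localization.AtPrime p) L]
    (d : ℕ) (hd : Algebra.trdeg κ L = d)
    (h : Module.finrank p.ResidueField (p.ResidueField ⊗[A] Ω[A⁄κ]) ≤ d) :
    Algebra.FormallySmooth κ (Localization.AtPrime p) := by
  let T := Localization.AtPrime p
  let k := p.ResidueField
  let v : A → k ⊗[A] Ω[A⁄κ] := fun x => 1 ⊗ₜ D κ A x
  have hv : Submodule.span k (Set.range v) = ⊤ := by
    have h1 := KaehlerDifferential.span_range_derivation κ A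
    have h2 := congrArg (Submodule.baseChange k) h1
    rw [Submodule.baseChange_span, Submodule.baseChange_top, ← Set.range_comp] at h2
    exact h2
  obtain ⟨ι, a, ha, hs, hli⟩ := exists_linearIndependent' k v
  have : Finite ι := hli.finite
  have := Fintype.ofFinite ι
  have hcard : Fintype.card ι ≤ d := hli.fintype_card_le_finrank.trans h
  let P := MvPolynomial ι κ
  let : Algebra P A := (MvPolynomial.aeval a).toRingHom.toAlgebra
  have hX : ∀ i, algebraMap P A (MvPolynomial.X i) = a i := fun i => MvPolynomial.aeval_X a i
  have : IsScalarTower κ P A := .of_algebraMap_eq fun x => ((MvPolynomial.aeval a).commutes x).symm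
  have : Algebra.FiniteType P A := .of_restrictScalars_finiteType κ P A
  have hun : Algebra.FormallyUnramified P T := by
    refine aux_unram (κ := κ) p (fun i => (MvPolynomial.X i : P)) ?_
    simp only [hX]
    rw [← hv, ← hs]; rfl
  let : Algebra P L := ((algebraMap A L).comp (algebraMap P A)).toAlgebra
  have : IsScalarTower P A L := .of_algebraMap_eq' rfl
  have : IsScalarTower P T L := .of_algebraMap_eq fun x => by
    rw [IsScalarTower.algebraMap_apply P A T, ← IsScalarTower.algebraMap_apply A T L]; rfl
  have : IsScalarTower κ P L := .of_algebraMap_eq fun x => by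
    rw [IsScalarTower.algebraMap_apply P A L, ← IsScalarTower.algebraMap_apply κ P A,
      ← IsScalarTower.algebraMap_apply κ A L]
  have : Algebra.FormallyUnramified T L := .of_restrictScalars A T L
  have : Algebra.FormallyUnramified P L := .comp P T L
  have hinjL : Function.Injective (algebraMap P L) := aux_indep (by
    rw [hd]; simpa using hcard)
  have hinj : Function.Injective (algebraMap P T) := by
    rw [IsScalarTower.algebraMap_eq P T L, RingHom.coe_comp] at hinjL
    exact hinjL.of_comp
  have : Algebra.IsUnramifiedAt P p := hun
  obtain ⟨f, hfp, Q, φ, hφ⟩ := Algebra.IsUnramifiedAt.exists_hasStandardEtaleSurjectionOn (R := P) p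
  let ψ : Localization.Away f →+* T :=
    IsLocalization.Away.lift f (g := algebraMap A T) 
      (IsLocalization.map_units T (⟨f, hfp⟩ : p.primeCompl))
  have hψ : ∀ x, ψ (algebraMap A _ x) = algebraMap A T x := IsLocalization.Away.lift_eq f _
  let : Algebra Q.Ring T := (ψ.comp φ.toRingHom).toAlgebra
  have hQ : ∀ x, algebraMap Q.Ring T x = ψ (φ x) := fun _ => rfl
  have : IsScalarTower P Q.Ring T := .of_algebraMap_eq fun x => by
    rw [hQ, AlgHom.commutes, IsScalarTower.algebraMap_apply P A (Localization.Away f), hψ,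
      ← IsScalarTower.algebraMap_apply P A T]
  have : Algebra.FormallyEtale P T := by
    refine aux_loc (E := Q.Ring) hinj fun z => ?_
    obtain ⟨⟨x, s⟩, hxs⟩ := IsLocalization.surj p.primeCompl z
    obtain ⟨x', hx'⟩ := hφ (algebraMap A _ x)
    obtain ⟨s', hs'⟩ := hφ (algebraMap A _ s)
    refine ⟨x', s', ?_, ?_⟩
    · rw [hQ, hs', hψ]; exact IsLocalization.map_units T s
    · rw [hQ, hQ, hs', hx', hψ, hψ]; exact hxs
  exact .comp κ P T

open KaehlerDifferential in
lemma aux_rank {κ A T K : Type} [Field κ] [CommRing A] [Algebra κ A]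
    [CommRing T] [IsLocalRing T] [Algebra κ T] [Algebra A T] [IsScalarTower κ A T]
    [Algebra.FormallyEtale A T] [Field K] [Algebra A K] [Algebra T K] [IsScalarTower A T K]
    [Algebra.EssFiniteType κ T] [Algebra.FormallySmooth κ T] :
    Module.finrank K (K ⊗[A] Ω[A⁄κ]) = Module.finrank T Ω[T⁄κ] := by
  have : Module.Free T Ω[T⁄κ] := Module.free_of_flat_of_isLocalRing
  rw [← Module.finrank_baseChange (R := K) (S := T) (M' := Ω[T⁄κ])]
  exact ((AlgebraTensorModule.cancelBaseChange A T K K Ω[A⁄κ]).symm.trans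
    (AlgebraTensorModule.congr (LinearEquiv.refl K K)
      (tensorKaehlerEquivOfFormallyEtale κ A T))).finrank_eq

lemma aux_minimal {A : Type} [CommRing A] [IsReduced A] (q : Ideal A) [q.IsPrime]
    (hq : q ∈ minimalPrimes A) : Algebra.FormallyEtale A q.ResidueField := by
  have hF : IsField (Localization.AtPrime q) := by
    have := IsLocalization.subsingleton_primeSpectrum_of_mem_minimalPrimes q hq
      (Localization.AtPrime q)
    have : Ring.KrullDimLE 0 (Localization.AtPrime q) := by
      refine Ring.krullDimLE_zero_iff.mpr fun I hI => ?_
      have : (⟨I, hI⟩ : PrimeSpectrum (Localization.AtPrime q)) =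
        ⟨IsLocalRing.maximalIdeal _, inferInstance⟩ := Subsingleton.elim _ _
      have h2 : I = IsLocalRing.maximalIdeal _ := congrArg PrimeSpectrum.asIdeal this
      rw [h2]; infer_instance
    exact Ring.KrullDimLE.isField_of_isReduced
  let := hF.toField
  have hb : Function.Bijective (algebraMap (Localization.AtPrime q) q.ResidueField) :=
    ⟨RingHom.injective _, IsLocalRing.residue_surjective⟩
  have : Algebra.FormallyEtale (Localization.AtPrime q) q.ResidueField :=
    .of_equiv (AlgEquiv.ofBijective (Algebra.ofId _ _) hb)
  have : Algebra.FormallyEtale A (Localization.AtPrime q) := .of_isLocalization q.primeCompl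
  exact .comp A (Localization.AtPrime q) q.ResidueField

theorem fitt_kaehler_le_prime_iff_not_smooth
    (κ : Type) [Field κ] [IsAlgClosed κ]
    (A : Type) [CommRing A] [Algebra κ A] [Algebra.FiniteType κ A] [IsReduced A]
    (d : ℕ)
    (hdim : ∀ (q : Ideal A) (_ : q.IsPrime), q ∈ minimalPrimes A →
      ringKrullDim (A ⧸ q) = (d : WithBot (WithTop ℕ)))
    (m r : ℕ) (φ : (Fin m → A) →ₗ[A] (Fin r → A))
    (π : (Fin r → A) →ₗ[A] KaehlerDifferential κ A)
    (hπ : Function.Surjective π)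
    (hexact : LinearMap.range φ = LinearMap.ker π)
    (p : Ideal A) (hp : p.IsPrime) :
    minorsIdeal (LinearMap.toMatrix (Pi.basisFun A (Fin m)) (Pi.basisFun A (Fin r)) φ)
        ((r : ℤ) - (d : ℤ)) ≤ p ↔
      ¬ (letI : Algebra κ (Localization (@Ideal.primeCompl A _ p hp)) :=
          ((algebraMap A (Localization (@Ideal.primeCompl A _ p hp))).comp
            (algebraMap κ A)).toAlgebra
         Algebra.FormallySmooth κ (Localization (@Ideal.primeCompl A _ p hp))) := by
  rw [aux_fitt (k := p.ResidueField) d m r φ π hπ hexact p (Ideal.ker_algebraMap_residueField p)]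
  have hinst : ((algebraMap A (Localization (@Ideal.primeCompl A _ p hp))).comp
            (algebraMap κ A)).toAlgebra =
      (inferInstance : Algebra κ (Localization (@Ideal.primeCompl A _ p hp))) := by
    refine Algebra.algebra_ext _ _ fun x => ?_
    exact (IsScalarTower.algebraMap_apply κ A (Localization p.primeCompl) x).symm
  rw [hinst]
  change _ ↔ ¬ Algebra.FormallySmooth κ (Localization.AtPrime p)
  obtain ⟨q, hq, hqp⟩ := Ideal.exists_minimalPrimes_le (I := (⊥ : Ideal A)) (J := p) bot_le
  have hqprime : q.IsPrime := hq.1.1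
  let L := q.ResidueField
  have hd : Algebra.trdeg κ L = d := aux_trdeg (B := A ⧸ q) d (hdim q hqprime hq)
  have hEt : Algebra.FormallyEtale A L := aux_minimal q hq
  have : Algebra.EssFiniteType κ L := .comp κ A L
  let T := Localization.AtPrime p
  have hunit : ∀ y : p.primeCompl, IsUnit (algebraMap A L y) := fun y => by
    rw [isUnit_iff_ne_zero, Ne, Ideal.algebraMap_residueField_eq_zero]
    exact fun hy => y.2 (hqp hy)
  let : Algebra T L := (IsLocalization.lift (S := T) hunit).toAlgebra
  have : IsScalarTower A T L := .of_algebraMap_eq fun x => (IsLocalization.lift_eq hunit x).symm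
  constructor
  · intro hlt hsm
    have : Algebra.FormallyEtale A T := .of_isLocalization p.primeCompl
    have : Algebra.FormallySmooth κ T := hsm
    have : Algebra.EssFiniteType κ T := .comp κ A T
    have h1 := aux_rank (κ := κ) (A := A) (T := T) (K := p.ResidueField)
    have h2 := aux_rank (κ := κ) (A := A) (T := T) (K := L)
    have h3 := (KaehlerDifferential.tensorKaehlerEquivOfFormallyEtale κ A L).finrank_eq
    have h4 := aux_diff (κ := κ) (L := L) d hd
    omega
  · intro hns
    by_contra hle
    exact hns (aux_smooth (L := L) p d hd (not_lt.mp hle))
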